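/- For every integer m ≥ 1 and every real number λ': λ' is an eigenvalue of −Δ_{m+1} (i.e., there exists a λ'-eigenfunction of −Δ_{m+1}) if and only if λ' = 1 or R(λ') is an eigenvalue of −Δ_m. -/

import Mathlib

open scoped BigOperators

noncomputable section

namespace VNLE

/-- `N_m = 2·5^m`, the number of points on the circle at level `m`. -/
def Nm (m : ℕ) : ℕ := 2 * 5 ^ m

/-- The partner of a vertex `n` of `K_m`: writing the representative `v` of `n`
(taking `v = 2·5^m` when `n = 0`) as `v = 5^k·a` with `5 ∤ a`, the partner is
`n + 5^k` if `a ≡ 1` or `3 (mod 5)`, and `n - 5^k` if `a ≡ 2` or `4 (mod 5)`.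
This realizes the identifications `5^k(1+5j) ∼ 5^k(2+5j)` and
`5^k(3+5j) ∼ 5^k(4+5j)` in `ℤ/(2·5^m)ℤ`. -/
def partner (m : ℕ) (n : ZMod (Nm m)) : ZMod (Nm m) :=
  let v : ℕ := if n.val = 0 then Nm m else n.val
  let k : ℕ := padicValNat 5 v
  if (v / 5 ^ k) % 5 = 1 ∨ (v / 5 ^ k) % 5 = 3 then n + ((5 ^ k : ℕ) : ZMod (Nm m))
  else n - ((5 ^ k : ℕ) : ZMod (Nm m))

/-- A function on `K_m`: a map on `ℤ/N_mℤ` constant on the identified pairs. -/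
def IsKFun (m : ℕ) (u : ZMod (Nm m) → ℝ) : Prop := ∀ n, u (partner m n) = u n

/-- The graph Laplacian `−Δ_m`. -/
def lap (m : ℕ) (u : ZMod (Nm m) → ℝ) : ZMod (Nm m) → ℝ := fun n =>
  4 * u n - u (n + 1) - u (n - 1) - u (partner m n + 1) - u (partner m n - 1)

/-- `u` is a `λ`-eigenfunction of `−Δ_m`. -/
def IsEigen (m : ℕ) (lam : ℝ) (u : ZMod (Nm m) → ℝ) : Prop :=
  IsKFun m u ∧ u ≠ 0 ∧ ∀ n, lap m u n = lam * u n

/-- The spectral decimation renormalization polynomial `R(x) = x(3−x)(5−x)`. -/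
def R (x : ℝ) : ℝ := x * (3 - x) * (5 - x)

/-- The `λ'`-extension of a function on `K_m` to a function on `K_{m+1}`. -/
def extFun (m : ℕ) (lam' : ℝ) (u : ZMod (Nm m) → ℝ) : ZMod (Nm (m + 1)) → ℝ := fun x =>
  let n : ZMod (Nm m) := ((x.val / 5 : ℕ) : ZMod (Nm m))
  if x.val % 5 = 0 then u n
  else if x.val % 5 = 1 ∨ x.val % 5 = 2 then
    ((2 - lam') * u n + u (n + 1)) / ((1 - lam') * (3 - lam'))
  else
    (u n + (2 - lam') * u (n + 1)) / ((1 - lam') * (3 - lam'))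

/-- Restriction of a function on `K_{m+1}` to the old vertices, giving a function on `K_m`. -/
def down (m : ℕ) (v : ZMod (Nm (m + 1)) → ℝ) : ZMod (Nm m) → ℝ := fun n =>
  v (((5 * n.val : ℕ) : ZMod (Nm (m + 1))))

/-- The Laplacian `−Δ_m` as a linear map. -/
def lapL (m : ℕ) : (ZMod (Nm m) → ℝ) →ₗ[ℝ] (ZMod (Nm m) → ℝ) where
  toFun := lap m
  map_add' u v := by funext n; simp only [lap, Pi.add_apply]; ring
  map_smul' c u := by funext n; simp only [lap, Pi.smul_apply, smul_eq_mul, RingHom.id_apply]; ring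

/-- The subspace of functions on `K_m` (maps constant on identified pairs). -/
def KFunSub (m : ℕ) : Submodule ℝ (ZMod (Nm m) → ℝ) where
  carrier := {u | IsKFun m u}
  add_mem' := by
    intro u v hu hv n
    simp only [Pi.add_apply, hu n, hv n]
  zero_mem' := fun _ => rfl
  smul_mem' := by
    intro c u hu n
    simp only [Pi.smul_apply, hu n]

/-- The `λ`-eigenspace of `−Δ_m` inside the space of functions on `K_m`. -/
def eigensp (m : ℕ) (lam : ℝ) : Submodule ℝ (ZMod (Nm m) → ℝ) :=
  LinearMap.ker (lapL m - lam • LinearMap.id) ⊓ KFunSub m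

/-- `c = (8 − √19)/3`, the smaller critical point of `R`. -/
def cpt : ℝ := (8 - Real.sqrt 19) / 3

/-- `φ₁`, the inverse of the (strictly increasing) restriction of `R` to `[0, c]`. -/
def phi1 : ℝ → ℝ := Function.invFunOn R (Set.Icc 0 cpt)

/-- Eigenvalue counting function: total dimension of the eigenspaces of `−Δ_m`
with eigenvalue `≤ t`. -/
def evCount (m : ℕ) (t : ℝ) : ℕ :=
  Module.finrank ℝ ↥(⨆ lam ∈ Set.Iic t, eigensp m lam)

/-- `evSorted m k = λ_k(m)`, the `k`-th smallest eigenvalue (with multiplicity,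
`1 ≤ k ≤ 5^m`) of `−Δ_m` acting on functions on `K_m`. -/
def evSorted (m k : ℕ) : ℝ := sInf {t : ℝ | k ≤ evCount m t}

/-- The restriction of a function on the circle `ℝ/ℤ` to the level-`m` vertices. -/
def restr (u : AddCircle (1 : ℝ) → ℝ) (m : ℕ) : ZMod (Nm m) → ℝ := fun n =>
  u (((n.val : ℝ) / (Nm m : ℝ) : ℝ) : AddCircle (1 : ℝ))

/-- A continuous function on the circle is admissible if at every level its values
agree on identified pairs, so that its restrictions are functions on `K_m`. -/
def Admissible (u : AddCircle (1 : ℝ) → ℝ) : Prop :=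
  Continuous u ∧ ∀ m, 1 ≤ m → ∀ n : ZMod (Nm m), restr u m (partner m n) = restr u m n

/-- `u` is a `λ`-eigenfunction of `−Δ` on `K`: it is admissible, nonzero, and
`sup_n |15^m (−Δ_m u_m)(n) − λ u(n/N_m)| → 0` as `m → ∞`. -/
def IsEigenK (lam : ℝ) (u : AddCircle (1 : ℝ) → ℝ) : Prop :=
  Admissible u ∧ u ≠ 0 ∧
    ∀ ε : ℝ, 0 < ε → ∃ M : ℕ, ∀ m, M ≤ m → ∀ n : ZMod (Nm m),
      |(15 : ℝ) ^ m * lap m (restr u m) n - lam * restr u m n| < ε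

/-- The symmetry-type subspace `V_{ε₁,ε₂}` of functions on `K_m`. -/
def symSub (m : ℕ) (e1 e2 : ℝ) : Submodule ℝ (ZMod (Nm m) → ℝ) where
  carrier := {u | IsKFun m u ∧ (∀ n, u (-n) = e1 * u n) ∧
    (∀ n, u (((5 ^ m : ℕ) : ZMod (Nm m)) - n) = e2 * u n)}
  add_mem' := by
    rintro u v ⟨hu, hu1, hu2⟩ ⟨hv, hv1, hv2⟩
    refine ⟨fun n => by simp only [Pi.add_apply, hu n, hv n],
      fun n => by simp only [Pi.add_apply, hu1 n, hv1 n]; ring,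
      fun n => by simp only [Pi.add_apply, hu2 n, hv2 n]; ring⟩
  zero_mem' := ⟨fun _ => rfl, fun n => by simp, fun n => by simp⟩
  smul_mem' := by
    rintro c u ⟨hu, hu1, hu2⟩
    refine ⟨fun n => by simp only [Pi.smul_apply, hu n],
      fun n => by simp only [Pi.smul_apply, smul_eq_mul, hu1 n]; ring,
      fun n => by simp only [Pi.smul_apply, smul_eq_mul, hu2 n]; ring⟩

instance Nm_neZero (m : ℕ) : NeZero (Nm m) := ⟨by unfold Nm; positivity⟩

lemma Nm_succ (m : ℕ) : Nm (m + 1) = 5 * Nm m := by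
  unfold Nm; ring

/-- The inclusion of the vertices of `K_m` among those of `K_{m+1}`, multiplication by `5`. -/
def embed (m : ℕ) (n : ZMod (Nm m)) : ZMod (Nm (m + 1)) := ((5 * n.val : ℕ) : ZMod (Nm (m + 1)))

lemma embed_natCast (m k : ℕ) : embed m (k : ZMod (Nm m)) = ((5 * k : ℕ) : ZMod (Nm (m + 1))) := by
  rw [embed, ZMod.natCast_eq_natCast_iff, ZMod.val_natCast, Nm_succ]
  exact (Nat.mod_modEq k (Nm m)).mul_left' 5

lemma embed_add_natCast (m : ℕ) (n : ZMod (Nm m)) (k : ℕ) :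
    embed m (n + k) = embed m n + ((5 * k : ℕ) : ZMod (Nm (m + 1))) := by
  conv_lhs => rw [← ZMod.natCast_zmod_val n, ← Nat.cast_add, embed_natCast]
  rw [embed, mul_add, Nat.cast_add]

lemma embed_sub_natCast (m : ℕ) (n : ZMod (Nm m)) (k : ℕ) :
    embed m (n - k) = embed m n - ((5 * k : ℕ) : ZMod (Nm (m + 1))) := by
  rw [eq_sub_iff_add_eq, ← embed_add_natCast, sub_add_cancel]

lemma embed_add_one (m : ℕ) (n : ZMod (Nm m)) : embed m (n + 1) = embed m n + 5 := by
  simpa using embed_add_natCast m n 1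

lemma embed_sub_one (m : ℕ) (n : ZMod (Nm m)) : embed m (n - 1) = embed m n - 5 := by
  simpa using embed_sub_natCast m n 1

lemma val_embed_add (m : ℕ) (n : ZMod (Nm m)) {r : ℕ} (hr : r < 5) :
    (embed m n + (r : ZMod (Nm (m + 1)))).val = 5 * n.val + r := by
  rw [embed, ← Nat.cast_add, ZMod.val_natCast_of_lt]
  have := n.val_lt
  rw [Nm_succ]
  omega

lemma val_embed (m : ℕ) (n : ZMod (Nm m)) : (embed m n).val = 5 * n.val := by
  simpa using val_embed_add m n (r := 0) (by norm_num)

lemma exists_eq_embed_add (m : ℕ) (x : ZMod (Nm (m + 1))) :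
    ∃ n : ZMod (Nm m), ∃ r < 5, x = embed m n + (r : ℕ) := by
  refine ⟨((x.val / 5 : ℕ) : ZMod (Nm m)), x.val % 5, Nat.mod_lt _ (by norm_num), ?_⟩
  rw [embed_natCast, ← Nat.cast_add, Nat.div_add_mod, ZMod.natCast_zmod_val]

/-- Case distinction on the five vertices of `K_{m+1}` above a vertex of `K_m`. -/
lemma forall_embed_add {m : ℕ} {P : ZMod (Nm (m + 1)) → Prop}
    (h : ∀ n, P (embed m n) ∧ P (embed m n + 1) ∧ P (embed m n + 2) ∧ P (embed m n + 3) ∧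
      P (embed m n + 4)) (x : ZMod (Nm (m + 1))) : P x := by
  obtain ⟨n, r, hr, rfl⟩ := exists_eq_embed_add m x
  obtain ⟨h0, h1, h2, h3, h4⟩ := h n
  interval_cases r <;> simpa

lemma partner_embed (m : ℕ) (n : ZMod (Nm m)) :
    partner (m + 1) (embed m n) = embed m (partner m n) := by
  set v : ℕ := if n.val = 0 then Nm m else n.val with hv
  have hv0 : v ≠ 0 := by
    rw [hv]; split_ifs with h
    · exact NeZero.ne _
    · exact h
  have hv5 : (if (embed m n).val = 0 then Nm (m + 1) else (embed m n).val) = 5 * v := by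
    rw [val_embed, Nm_succ, hv]
    split_ifs <;> first | rfl | omega
  have hk : padicValNat 5 (5 * v) = padicValNat 5 v + 1 := by
    have : Fact (Nat.Prime 5) := ⟨Nat.prime_five⟩
    rw [padicValNat.mul (by norm_num) hv0, padicValNat_self, add_comm]
  have hd : 5 * v / 5 ^ (padicValNat 5 v + 1) = v / 5 ^ padicValNat 5 v := by
    rw [pow_succ', Nat.mul_div_mul_left _ _ (by norm_num)]
  simp only [partner, hv5, ← hv, hk, hd]
  split_ifs
  · rw [embed_add_natCast, pow_succ']
  · rw [embed_sub_natCast, pow_succ']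

lemma partner_embed_add (m : ℕ) (n : ZMod (Nm m)) {r : ℕ} (h0 : r ≠ 0) (h5 : r < 5) :
    partner (m + 1) (embed m n + (r : ZMod (Nm (m + 1)))) =
      if r = 1 ∨ r = 3 then embed m n + (r : ZMod (Nm (m + 1))) + 1
      else embed m n + (r : ZMod (Nm (m + 1))) - 1 := by
  have hk : padicValNat 5 (5 * n.val + r) = 0 := padicValNat.eq_zero_of_not_dvd (by omega)
  have hr : (5 * n.val + r) % 5 = r := by omega
  have hne : 5 * n.val + r ≠ 0 := by omega
  simp only [partner, val_embed_add m n h5, hne, if_false, hk, pow_zero, Nat.div_one, hr,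
    Nat.cast_one]

lemma partner_embed_add_one (m : ℕ) (n : ZMod (Nm m)) :
    partner (m + 1) (embed m n + 1) = embed m n + 2 := by
  have := partner_embed_add m n (r := 1) (by norm_num) (by norm_num)
  norm_num at this
  rw [this]; ring

lemma partner_embed_add_two (m : ℕ) (n : ZMod (Nm m)) :
    partner (m + 1) (embed m n + 2) = embed m n + 1 := by
  have := partner_embed_add m n (r := 2) (by norm_num) (by norm_num)
  norm_num at this
  rw [this]; ring

lemma partner_embed_add_three (m : ℕ) (n : ZMod (Nm m)) :
    partner (m + 1) (embed m n + 3) = embed m n + 4 := by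
  have := partner_embed_add m n (r := 3) (by norm_num) (by norm_num)
  norm_num at this
  rw [this]; ring

lemma partner_embed_add_four (m : ℕ) (n : ZMod (Nm m)) :
    partner (m + 1) (embed m n + 4) = embed m n + 3 := by
  have := partner_embed_add m n (r := 4) (by norm_num) (by norm_num)
  norm_num at this
  rw [this]; ring

lemma isKFun_succ_iff {m : ℕ} {v : ZMod (Nm (m + 1)) → ℝ} :
    IsKFun (m + 1) v ↔ IsKFun m (fun n => v (embed m n)) ∧
      ∀ n, v (embed m n + 2) = v (embed m n + 1) ∧ v (embed m n + 4) = v (embed m n + 3) := by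
  constructor
  · intro h
    refine ⟨fun n => ?_, fun n => ⟨?_, ?_⟩⟩
    · simpa only [partner_embed] using h (embed m n)
    · simpa only [partner_embed_add_one] using h (embed m n + 1)
    · simpa only [partner_embed_add_three] using h (embed m n + 3)
  · rintro ⟨h0, h⟩
    refine forall_embed_add fun n => ⟨?_, ?_, ?_, ?_, ?_⟩
    · simpa only [partner_embed] using h0 n
    · rw [partner_embed_add_one, (h n).1]
    · rw [partner_embed_add_two, (h n).1]
    · rw [partner_embed_add_three, (h n).2]
    · rw [partner_embed_add_four, (h n).2]

lemma lap_embed {m : ℕ} {v : ZMod (Nm (m + 1)) → ℝ} (hv : IsKFun (m + 1) v) (n : ZMod (Nm m)) :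
    lap (m + 1) v (embed m n) = 4 * v (embed m n) - v (embed m n + 1) - v (embed m (n - 1) + 3) -
      v (embed m (partner m n) + 1) - v (embed m (partner m n - 1) + 3) := by
  have h := (isKFun_succ_iff.1 hv).2
  rw [lap, partner_embed, ← (h _).2, ← (h (partner m n - 1)).2, embed_sub_one, embed_sub_one]
  ring_nf

/-- The eigenvalue equation on `K_{m+1}`, written cell by cell. -/
lemma lap_succ_eq_iff {m : ℕ} {v : ZMod (Nm (m + 1)) → ℝ} (hv : IsKFun (m + 1) v) (t : ℝ) :
    (∀ x, lap (m + 1) v x = t * v x) ↔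
      ∀ n, (2 - t) * v (embed m n + 1) = v (embed m n) + v (embed m n + 3) ∧
        (2 - t) * v (embed m n + 3) = v (embed m (n + 1)) + v (embed m n + 1) ∧
        (4 - t) * v (embed m n) = v (embed m n + 1) + v (embed m (n - 1) + 3) +
          v (embed m (partner m n) + 1) + v (embed m (partner m n - 1) + 3) := by
  have hk := (isKFun_succ_iff.1 hv).2
  have e1 : ∀ y : ZMod (Nm (m + 1)), y + 1 - 1 = y := fun y => by ring
  have e2 : ∀ y : ZMod (Nm (m + 1)), y + 1 + 1 = y + 2 := fun y => by ring
  have e3 : ∀ y : ZMod (Nm (m + 1)), y + 2 - 1 = y + 1 := fun y => by ring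
  have e4 : ∀ y : ZMod (Nm (m + 1)), y + 2 + 1 = y + 3 := fun y => by ring
  have e5 : ∀ y : ZMod (Nm (m + 1)), y + 3 - 1 = y + 2 := fun y => by ring
  have e6 : ∀ y : ZMod (Nm (m + 1)), y + 3 + 1 = y + 4 := fun y => by ring
  have e7 : ∀ y : ZMod (Nm (m + 1)), y + 4 - 1 = y + 3 := fun y => by ring
  have e8 : ∀ y : ZMod (Nm (m + 1)), y + 4 + 1 = y + 5 := fun y => by ring
  have l1 : ∀ n, lap (m + 1) v (embed m n + 1) =
      2 * v (embed m n + 1) - v (embed m n) - v (embed m n + 3) := fun n => by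
    rw [lap, partner_embed_add_one, e1, e2, e3, e4, (hk n).1]; ring
  have l2 : ∀ n, lap (m + 1) v (embed m n + 2) =
      2 * v (embed m n + 1) - v (embed m n) - v (embed m n + 3) := fun n => by
    rw [lap, partner_embed_add_two, e1, e2, e3, e4, (hk n).1]; ring
  have l3 : ∀ n, lap (m + 1) v (embed m n + 3) =
      2 * v (embed m n + 3) - v (embed m (n + 1)) - v (embed m n + 1) := fun n => by
    rw [lap, partner_embed_add_three, e5, e6, e7, e8, (hk n).1, (hk n).2, embed_add_one]; ring
  have l4 : ∀ n, lap (m + 1) v (embed m n + 4) =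
      2 * v (embed m n + 3) - v (embed m (n + 1)) - v (embed m n + 1) := fun n => by
    rw [lap, partner_embed_add_four, e5, e6, e7, e8, (hk n).1, (hk n).2, embed_add_one]; ring
  constructor
  · intro h n
    have h0 := h (embed m n)
    have h1 := h (embed m n + 1)
    have h3 := h (embed m n + 3)
    rw [lap_embed hv] at h0
    rw [l1] at h1
    rw [l3] at h3
    exact ⟨by linarith, by linarith, by linarith⟩
  · intro h
    refine forall_embed_add fun n => ?_
    obtain ⟨h1, h3, h0⟩ := h n
    rw [lap_embed hv, l1, l2, l3, l4, (hk n).1, (hk n).2]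
    exact ⟨by linarith, by linarith, by linarith, by linarith, by linarith⟩

/-- The function on the vertices of `K_{m+1}` with value `p n` at `5n`, `a n` at `5n + 1`, `5n + 2`
and `b n` at `5n + 3`, `5n + 4`. -/
def glue (m : ℕ) (p a b : ZMod (Nm m) → ℝ) (x : ZMod (Nm (m + 1))) : ℝ :=
  let n : ZMod (Nm m) := ((x.val / 5 : ℕ) : ZMod (Nm m))
  if x.val % 5 = 0 then p n else if x.val % 5 = 1 ∨ x.val % 5 = 2 then a n else b n

lemma glue_embed_add (m : ℕ) (p a b : ZMod (Nm m) → ℝ) (n : ZMod (Nm m)) {r : ℕ} (hr : r < 5) :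
    glue m p a b (embed m n + (r : ZMod (Nm (m + 1)))) =
      if r = 0 then p n else if r = 1 ∨ r = 2 then a n else b n := by
  have h1 : (5 * n.val + r) / 5 = n.val := by omega
  have h2 : (5 * n.val + r) % 5 = r := by omega
  simp only [glue, val_embed_add m n hr, h1, h2, ZMod.natCast_zmod_val]

/-- Functions on `K_m` and values on the new vertices which solve the eigenvalue equation cell by
cell produce an eigenfunction on `K_{m+1}`. -/
lemma isEigen_glue {m : ℕ} {t : ℝ} {p a b : ZMod (Nm m) → ℝ} (hp : IsKFun m p)
    (hne : p ≠ 0 ∨ a ≠ 0)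
    (h : ∀ n, (2 - t) * a n = p n + b n ∧ (2 - t) * b n = p (n + 1) + a n ∧
      (4 - t) * p n = a n + b (n - 1) + a (partner m n) + b (partner m n - 1)) :
    IsEigen (m + 1) t (glue m p a b) := by
  have g0 : ∀ n, glue m p a b (embed m n) = p n := fun n => by
    simpa using glue_embed_add m p a b n (r := 0) (by norm_num)
  have g1 : ∀ n, glue m p a b (embed m n + 1) = a n := fun n => by
    simpa using glue_embed_add m p a b n (r := 1) (by norm_num)
  have g2 : ∀ n, glue m p a b (embed m n + 2) = a n := fun n => by
    simpa using glue_embed_add m p a b n (r := 2) (by norm_num)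
  have g3 : ∀ n, glue m p a b (embed m n + 3) = b n := fun n => by
    simpa using glue_embed_add m p a b n (r := 3) (by norm_num)
  have g4 : ∀ n, glue m p a b (embed m n + 4) = b n := fun n => by
    simpa using glue_embed_add m p a b n (r := 4) (by norm_num)
  have hk : IsKFun (m + 1) (glue m p a b) := by
    rw [isKFun_succ_iff]
    simpa [g0, g1, g2, g3, g4] using hp
  refine ⟨hk, fun h0 => ?_, (lap_succ_eq_iff hk t).2 fun n => ?_⟩
  · rcases hne with hne | hne
    · exact hne (funext fun n => by rw [← g0, h0]; rfl)
    · exact hne (funext fun n => by rw [← g1, h0]; rfl)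
  · simpa only [g0, g1, g3] using h n

lemma isEigen_zero_const (m : ℕ) : IsEigen m 0 fun _ => 1 :=
  ⟨fun _ => rfl, fun h => one_ne_zero (congrFun h 0), fun _ => by simp only [lap]; norm_num⟩

lemma exists_isEigen_one (m : ℕ) : ∃ u, IsEigen (m + 1) 1 u := by
  have hdvd : 2 ∣ Nm m := Dvd.intro _ rfl
  let f : ZMod (Nm m) →+* ZMod 2 := ZMod.castHom hdvd (ZMod 2)
  let s : ZMod 2 → ℝ := fun z => if z = 0 then 1 else -1
  have hs : ∀ z, s z + s (z - 1) = 0 := by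
    intro z
    have hz : ∀ z : ZMod 2, z = 0 ∧ z - 1 ≠ 0 ∨ z ≠ 0 ∧ z - 1 = 0 := by decide
    rcases hz z with ⟨h, h'⟩ | ⟨h, h'⟩ <;> simp only [s, if_pos, if_neg, h, h', not_false_eq_true]
      <;> norm_num
  have hc : ∀ n, s (f n) + s (f (n - 1)) = 0 := fun n => by
    rw [map_sub, map_one]; exact hs _
  refine ⟨_, isEigen_glue (p := 0) (a := fun n => s (f n)) (b := fun n => s (f n))
    (fun _ => rfl) (Or.inr fun h => ?_) fun n => ⟨?_, ?_, ?_⟩⟩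
  · have := congrFun h 0
    simp [s] at this
  · simp only [Pi.zero_apply]; ring
  · simp only [Pi.zero_apply]; ring
  · simp only [Pi.zero_apply]; linarith [hc n, hc (partner m n)]

lemma exists_isEigen_three (m : ℕ) : ∃ u, IsEigen (m + 1) 3 u :=
  ⟨_, isEigen_glue (p := 0) (a := fun _ => 1) (b := fun _ => -1) (fun _ => rfl)
    (Or.inr fun h => one_ne_zero (congrFun h 0))
    fun _ => by simp only [Pi.zero_apply]; norm_num⟩

/-- Restriction to the old vertices sends eigenfunctions to eigenfunctions. -/
lemma IsEigen.comp_embed {m : ℕ} {t : ℝ} {v : ZMod (Nm (m + 1)) → ℝ} (hv : IsEigen (m + 1) t v)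
    (h1 : t ≠ 1) (h3 : t ≠ 3) : IsEigen m (R t) fun n => v (embed m n) := by
  obtain ⟨hk, hne, hl⟩ := hv
  have hK := isKFun_succ_iff.1 hk
  have hE := (lap_succ_eq_iff hk t).1 hl
  have hD : (1 - t) * (3 - t) ≠ 0 :=
    mul_ne_zero (sub_ne_zero.2 h1.symm) (sub_ne_zero.2 h3.symm)
  have ha : ∀ n, (1 - t) * (3 - t) * v (embed m n + 1) =
      (2 - t) * v (embed m n) + v (embed m (n + 1)) := fun n => by
    linear_combination (2 - t) * (hE n).1 + (hE n).2.1
  have hb : ∀ n, (1 - t) * (3 - t) * v (embed m n + 3) =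
      v (embed m n) + (2 - t) * v (embed m (n + 1)) := fun n => by
    linear_combination (hE n).1 + (2 - t) * (hE n).2.1
  refine ⟨hK.1, fun h => hne (funext (forall_embed_add fun n => ?_)), fun n => ?_⟩
  · have h0 : ∀ n, v (embed m n) = 0 := congrFun h
    have a0 : v (embed m n + 1) = 0 := by simpa [h0, hD] using ha n
    have b0 : v (embed m n + 3) = 0 := by simpa [h0, hD] using hb n
    exact ⟨h0 n, a0, (hK.2 n).1.trans a0, b0, (hK.2 n).2.trans b0⟩
  · have hb1 := hb (n - 1)
    have hb2 := hb (partner m n - 1)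
    rw [sub_add_cancel] at hb1 hb2
    have hpn : v (embed m (partner m n)) = v (embed m n) := hK.1 n
    simp only [lap, R]
    linear_combination (1 - t) * (3 - t) * (hE n).2.2 + ha n + hb1 + ha (partner m n) + hb2 +
      2 * (2 - t) * hpn

/-- Spectral decimation extends eigenfunctions from `K_m` to `K_{m+1}`. -/
lemma IsEigen.exists_succ {m : ℕ} {t : ℝ} {u : ZMod (Nm m) → ℝ} (hu : IsEigen m (R t) u)
    (h1 : t ≠ 1) (h3 : t ≠ 3) : ∃ v, IsEigen (m + 1) t v := by
  obtain ⟨hk, hne, hl⟩ := hu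
  have h1' : 1 - t ≠ 0 := sub_ne_zero.2 h1.symm
  have h3' : 3 - t ≠ 0 := sub_ne_zero.2 h3.symm
  refine ⟨_, isEigen_glue (p := u)
    (a := fun n => ((2 - t) * u n + u (n + 1)) / ((1 - t) * (3 - t)))
    (b := fun n => (u n + (2 - t) * u (n + 1)) / ((1 - t) * (3 - t)))
    hk (Or.inl hne) fun n => ⟨?_, ?_, ?_⟩⟩
  · field_simp
    ring
  · field_simp
    ring
  · have hln := hl n
    have hpn := hk n
    simp only [lap, R] at hln
    simp only [sub_add_cancel]
    rw [hpn]
    field_simp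
    linear_combination hln

/-- `λ'` is an eigenvalue of `−Δ_{m+1}` iff `λ' = 1` or `R(λ')` is an
eigenvalue of `−Δ_m`. -/
theorem eigenvalue_iff (m : ℕ) (hm : 1 ≤ m) (lam' : ℝ) :
    (∃ u, IsEigen (m + 1) lam' u) ↔ lam' = 1 ∨ ∃ u, IsEigen m (R lam') u := by
  have hR3 : R 3 = 0 := by norm_num [R]
  by_cases h1 : lam' = 1
  · simpa [h1] using exists_isEigen_one m
  by_cases h3 : lam' = 3
  · rw [h3, hR3]
    exact iff_of_true (exists_isEigen_three m) (Or.inr ⟨_, isEigen_zero_const m⟩)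
  · constructor
    · rintro ⟨v, hv⟩
      exact Or.inr ⟨_, hv.comp_embed h1 h3⟩
    · rintro (h | ⟨u, hu⟩)
      · exact absurd h h1
      · exact hu.exists_succ h1 h3

end VNLE
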